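/- Let d ≥ 1 and suppose S satisfies Assumptions Ω and J with constants M, K, ζ (the (d−1)-th moment bounds required of the class 𝒬 when d ≥ 4 are not needed for this result). Then: (a) Ω̄ is strictly convex and every μ ∈ Ω̄ satisfies ‖μ‖₂² ≤ M/K; (b) for every μ ∈ Ω̄, ∑_y J(y)e^{μ·y} ≤ 1, with equality if and only if μ ∈ ∂Ω; (c) for each nonzero x ∈ ℝ^d there is a unique μ_x̂ ∈ ∂Ω, depending only on the direction x̂ = x/‖x‖₂, such that μ_x̂·x = max_{μ∈Ω̄} μ·x; (d) the vector η_x̂ = ∑_y y J(y)e^{μ_x̂·y} satisfies η_x̂ = ‖η_x̂‖₂ x̂; (e) there exist constants 0 < c ≤ C depending only on d, M, K such that c m_S‖x‖₂ ≤ μ_x̂·x ≤ C m_S‖x‖₂, c m_S ≤ ‖η_x̂‖₂ ≤ C m_S, and c‖k‖₂² ≤ k·Λ_x̂ k ≤ C‖k‖₂² for all k ∈ ℝ^d, where Λ_x̂ ∈ ℝ^{d×d} has entries (Λ_x̂)_{jl} = ∑_y y_j y_l J(y)e^{μ_x̂·y}. -/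

import Mathlib

open scoped BigOperators ENNReal Real Topology Pointwise
open MeasureTheory Matrix Filter

noncomputable section

namespace OZpaper

variable {d : ℕ}

/-- Dot product of a real vector with a lattice point. -/
def rdotZ (μ : Fin d → ℝ) (x : Fin d → ℤ) : ℝ := ∑ i, μ i * (x i : ℝ)

/-- Dot product of two real vectors. -/
def rdot (μ x : Fin d → ℝ) : ℝ := ∑ i, μ i * x i

/-- Euclidean norm of a lattice point. -/
def enormZ (x : Fin d → ℤ) : ℝ := Real.sqrt (∑ i, ((x i : ℝ)) ^ 2)

/-- Euclidean norm of a real vector. -/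
def enormR (x : Fin d → ℝ) : ℝ := Real.sqrt (∑ i, (x i) ^ 2)

/-- ℓ¹ norm of a real vector. -/
def l1R (x : Fin d → ℝ) : ℝ := ∑ i, |x i|

/-- ℓ∞ norm of a real vector. -/
def linftyR (x : Fin d → ℝ) : ℝ := ⨆ i, |x i|

/-- The vector `t • e₁`. -/
def e1R (d : ℕ) (t : ℝ) : Fin d → ℝ := fun i => if (i : ℕ) = 0 then t else 0

/-- The lattice point `n • e₁`. -/
def e1Z (d : ℕ) (n : ℤ) : Fin d → ℤ := fun i => if (i : ℕ) = 0 then n else 0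

/-- Cast of a lattice point to a real vector. -/
def toR (x : Fin d → ℤ) : Fin d → ℝ := fun i => (x i : ℝ)

/-- ℤ^d-symmetry: invariance under coordinate permutations and sign flips. -/
def ZdSymmetric (f : (Fin d → ℤ) → ℝ) : Prop :=
  (∀ (σ : Equiv.Perm (Fin d)) (x : Fin d → ℤ), f (fun i => x (σ i)) = f x) ∧
  (∀ (ε : Fin d → Bool) (x : Fin d → ℤ), f (fun i => if ε i then -(x i) else x i) = f x)

/-- Tilted susceptibility `χ^{(μ)}`, valued in `ℝ≥0∞`. -/
def chi (S : (Fin d → ℤ) → ℝ) (μ : Fin d → ℝ) : ℝ≥0∞ :=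
  ∑' x, ENNReal.ofReal (S x * Real.exp (rdotZ μ x))

/-- The set `Ω = {μ : χ^{(μ)} < ∞}`. -/
def Omega (S : (Fin d → ℤ) → ℝ) : Set (Fin d → ℝ) := {μ | chi S μ < ⊤}

/-- The mass `m_S`. -/
def mass (S : (Fin d → ℤ) → ℝ) : ℝ := sSup {t : ℝ | 0 ≤ t ∧ chi S (e1R d t) < ⊤}

/-- Assumption Ω. -/
structure AssumptionOmega (S : (Fin d → ℤ) → ℝ) : Prop where
  nonneg : ∀ x, 0 ≤ S x
  symm : ZdSymmetric S
  open_Omega : IsOpen (Omega S)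
  zero_mem : (0 : Fin d → ℝ) ∈ Omega S
  exists_not_mem : ∃ μ₁ : ℝ, 0 < μ₁ ∧ e1R d μ₁ ∉ Omega S

/-- Fourier transform `Q̂(k) = ∑_y Q(y) e^{-i k·y}`. -/
def fourierZ (Q : (Fin d → ℤ) → ℝ) (k : Fin d → ℝ) : ℂ :=
  ∑' y, (Q y : ℂ) * Complex.exp (-Complex.I * (rdotZ k y : ℂ))

/-- ℓ^p norm of a function on ℤ^d, valued in `ℝ≥0∞`. -/
def lpNorm (f : (Fin d → ℤ) → ℝ) (p : ℝ) : ℝ≥0∞ :=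
  (∑' y, ENNReal.ofReal (|f y| ^ p)) ^ (1 / p)

/-- The exponent `p_d`. -/
def pExp (d : ℕ) (ζ : ℝ) : ℝ := if d = 1 then 2 else (d : ℝ) / ((d : ℝ) - 2 + min ζ 2)

/-- The class 𝒬_{M,K,ζ} without the (d-1)-th moment bounds. -/
structure MemQweak (M K ζ : ℝ) (Q g : (Fin d → ℤ) → ℝ) : Prop where
  Q_l1 : lpNorm Q 1 ≤ ENNReal.ofReal M
  Q_moment : lpNorm (fun y => enormZ y ^ (2 + ζ) * Q y) 1 ≤ ENNReal.ofReal M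
  infrared : ∀ k : Fin d → ℝ, (∀ i, |k i| ≤ π) →
    K * enormR k ^ 2 ≤ (fourierZ Q 0 - fourierZ Q k).re
  g_l1 : lpNorm g 1 ≤ ENNReal.ofReal M
  g_zeta : lpNorm (fun y => enormZ y ^ ζ * g y) 1 ≤ ENNReal.ofReal M
  g_two : lpNorm (fun y => enormZ y ^ (2 : ℝ) * g y) (min (pExp d ζ) 2) ≤ ENNReal.ofReal M

/-- The class 𝒬_{M,K,ζ}. -/
structure MemQ (M K ζ : ℝ) (Q g : (Fin d → ℤ) → ℝ) : Prop where
  Q_l1 : lpNorm Q 1 ≤ ENNReal.ofReal M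
  Q_moment : lpNorm (fun y => enormZ y ^ (2 + ζ) * Q y) 1 ≤ ENNReal.ofReal M
  infrared : ∀ k : Fin d → ℝ, (∀ i, |k i| ≤ π) →
    K * enormR k ^ 2 ≤ (fourierZ Q 0 - fourierZ Q k).re
  g_l1 : lpNorm g 1 ≤ ENNReal.ofReal M
  g_zeta : lpNorm (fun y => enormZ y ^ ζ * g y) 1 ≤ ENNReal.ofReal M
  g_two : lpNorm (fun y => enormZ y ^ (2 : ℝ) * g y) (min (pExp d ζ) 2) ≤ ENNReal.ofReal M
  Q_dm1 : 4 ≤ d →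
    lpNorm (fun y => enormZ y ^ ((d : ℝ) - 1) * Q y) (min ((d : ℝ) / 3) 2) ≤ ENNReal.ofReal M
  g_dm1 : 4 ≤ d →
    lpNorm (fun y => enormZ y ^ ((d : ℝ) - 1) * g y) 2 ≤ ENNReal.ofReal M

/-- Convolution on ℤ^d. -/
def conv (f g : (Fin d → ℤ) → ℝ) (x : Fin d → ℤ) : ℝ := ∑' y, f (x - y) * g y

/-- Exponential tilt `f^{(μ)}`. -/
def tilt (f : (Fin d → ℤ) → ℝ) (μ : Fin d → ℝ) : (Fin d → ℤ) → ℝ :=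
  fun x => f x * Real.exp (rdotZ μ x)

/-- `∑_y f(y) e^{μ·y}`, i.e. `f̂^{(μ)}(0)`. -/
def tiltSum (f : (Fin d → ℤ) → ℝ) (μ : Fin d → ℝ) : ℝ := ∑' y, f y * Real.exp (rdotZ μ y)

/-- Assumption J. -/
structure AssumptionJ (S J h : (Fin d → ℤ) → ℝ) (M K ζ : ℝ) : Prop where
  M_pos : 0 < M
  K_pos : 0 < K
  zeta_pos : 0 < ζ
  J_symm : ZdSymmetric J
  h_symm : ZdSymmetric h
  J_summable : Summable fun x => |J x|
  h_summable : Summable fun x => |h x|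
  OZ_eq : ∀ x, S x = h x + conv J S x
  memQ : ∀ μ ∈ closure (Omega S), MemQ M K ζ (tilt J μ) (tilt h μ)
  hhat_pos : ∀ μ ∈ closure (Omega S), 0 < tiltSum h μ

/-- Assumption J, without the (d-1)-th moment bounds of the class 𝒬. -/
structure AssumptionJweak (S J h : (Fin d → ℤ) → ℝ) (M K ζ : ℝ) : Prop where
  M_pos : 0 < M
  K_pos : 0 < K
  zeta_pos : 0 < ζ
  J_symm : ZdSymmetric J
  h_symm : ZdSymmetric h
  J_summable : Summable fun x => |J x|
  h_summable : Summable fun x => |h x|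
  OZ_eq : ∀ x, S x = h x + conv J S x
  memQ : ∀ μ ∈ closure (Omega S), MemQweak M K ζ (tilt J μ) (tilt h μ)
  hhat_pos : ∀ μ ∈ closure (Omega S), 0 < tiltSum h μ

/-- `μ` is the optimal tilt `μ_x̂` for direction `x`. -/
def IsOptTilt (S : (Fin d → ℤ) → ℝ) (x μ : Fin d → ℝ) : Prop :=
  μ ∈ frontier (Omega S) ∧ ∀ ν ∈ closure (Omega S), rdot ν x ≤ rdot μ x

/-- The norm `|x|_S = (max_{μ ∈ Ω̄} μ·x)/m_S`. -/
def normS (S : (Fin d → ℤ) → ℝ) (x : Fin d → ℝ) : ℝ :=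
  sSup ((fun μ => rdot μ x) '' closure (Omega S)) / mass S

/-- The drift vector `η` of the tilted kernel. -/
def etaOf (J : (Fin d → ℤ) → ℝ) (μ : Fin d → ℝ) : Fin d → ℝ :=
  fun j => ∑' y, (y j : ℝ) * J y * Real.exp (rdotZ μ y)

/-- The covariance matrix `Λ` of the tilted kernel. -/
def LambdaOf (J : (Fin d → ℤ) → ℝ) (μ : Fin d → ℝ) : Matrix (Fin d) (Fin d) ℝ :=
  Matrix.of fun j l => ∑' y, (y j : ℝ) * (y l : ℝ) * J y * Real.exp (rdotZ μ y)

/-- The Brownian heat kernel `ρ_t(x; η, Λ)`. -/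
def heatKer (d : ℕ) (t : ℝ) (x η : Fin d → ℝ) (Λ : Matrix (Fin d) (Fin d) ℝ) : ℝ :=
  (1 / Real.sqrt Λ.det) * (1 / (2 * π * t) ^ ((d : ℝ) / 2)) *
    Real.exp (-(1 / (2 * t)) * rdot (x - t • η) (Λ⁻¹ *ᵥ (x - t • η)))

/-- The Brownian Green function `𝒞(x; η, Λ)`. -/
def greenC (d : ℕ) (x η : Fin d → ℝ) (Λ : Matrix (Fin d) (Fin d) ℝ) : ℝ :=
  ∫ t in Set.Ioi (0 : ℝ), heatKer d t x η Λ

/-- The massive continuum Green function `𝔾_a(x)`. -/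
def massiveG (d : ℕ) (a : ℝ) (x : Fin d → ℝ) : ℝ :=
  ∫ t in Set.Ioi (0 : ℝ),
    (1 / (2 * π * t) ^ ((d : ℝ) / 2)) * Real.exp (-enormR x ^ 2 / (2 * t)) *
      Real.exp (-(t * a ^ 2) / 2)

/-- The constant `A_φ = ∫_{ℝ^d} ‖y‖₂^φ 𝔾₁(y) dy`. -/
def Aconst (d : ℕ) (φ : ℝ) : ℝ := ∫ y : Fin d → ℝ, enormR y ^ φ * massiveG d 1 y

/-- The torus `[-π, π]^d`. -/
def torus (d : ℕ) : Set (Fin d → ℝ) := Set.univ.pi fun _ => Set.Icc (-π) π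

/-- The Fourier integral `I_t(x)`. -/
def It (Q g : (Fin d → ℤ) → ℝ) (t : ℝ) (x : Fin d → ℤ) : ℂ :=
  (((2 * π) ^ d : ℝ) : ℂ)⁻¹ *
    ∫ k in torus d, Complex.exp (Complex.I * (rdotZ k x : ℂ)) * fourierZ g k *
      Complex.exp (-(t : ℂ) * (fourierZ Q 0 - fourierZ Q k))

/-- The quantity `G_Q(x)`. -/
def GQ (Q g : (Fin d → ℤ) → ℝ) (x : Fin d → ℤ) : ℂ :=
  ∫ t in Set.Ioi (0 : ℝ), It Q g t x

/-- The Kronecker delta at the origin. -/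
def deltaZ (d : ℕ) : (Fin d → ℤ) → ℝ := fun x => if x = 0 then 1 else 0

/-- n-fold convolution power. -/
def convPow (D : (Fin d → ℤ) → ℝ) : ℕ → (Fin d → ℤ) → ℝ
  | 0 => deltaZ d
  | n + 1 => conv D (convPow D n)

/-- Random-walk Green function `S_z(x) = ∑_n z^n D^{*n}(x)`. -/
def rwG (D : (Fin d → ℤ) → ℝ) (z : ℝ) (x : Fin d → ℤ) : ℝ :=
  ∑' n : ℕ, z ^ n * convPow D n x

/-- `σ² = ∑_x ‖x‖₂² J(x)`. -/
def sigmaSq (J : (Fin d → ℤ) → ℝ) : ℝ := ∑' x, enormZ x ^ 2 * J x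

/-- Susceptibility `χ = ∑_x S(x)`. -/
def suscept (S : (Fin d → ℤ) → ℝ) : ℝ := ∑' x, S x

/-- `ĥ(0) = ∑_x h(x)`. -/
def h0 (h : (Fin d → ℤ) → ℝ) : ℝ := ∑' x, h x

/-- Correlation length of order φ. -/
def xiPhi (S : (Fin d → ℤ) → ℝ) (φ : ℝ) : ℝ :=
  ((∑' x, enormZ x ^ φ * S x) / suscept S) ^ (1 / φ)

/-- A critical family of OZ systems. -/
structure CriticalFamily (d : ℕ) (δ zc M K ζ : ℝ) (S J h : ℝ → (Fin d → ℤ) → ℝ) : Prop where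
  δ_pos : 0 < δ
  assumOmega : ∀ z ∈ Set.Ico (zc - δ) zc, AssumptionOmega (S z)
  assumJ : ∀ z ∈ Set.Ico (zc - δ) zc, AssumptionJ (S z) (J z) (h z) M K ζ
  mass_tendsto : Tendsto (fun z => mass (S z)) (𝓝[<] zc) (𝓝 0)

/-- Convolution on ℤ. -/
def convZ (f g : ℤ → ℝ) (x : ℤ) : ℝ := ∑' y, f (x - y) * g y

/-- n-fold convolution power on ℤ. -/
def convZPow (f : ℤ → ℝ) : ℕ → ℤ → ℝ
  | 0 => fun x => if x = 0 then 1 else 0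
  | n + 1 => convZ f (convZPow f n)

lemma rdotZ_add (μ ν : Fin d → ℝ) (y : Fin d → ℤ) : rdotZ (μ + ν) y = rdotZ μ y + rdotZ ν y := by
  simp [rdotZ, add_mul, Finset.sum_add_distrib]

lemma rdotZ_smul (t : ℝ) (μ : Fin d → ℝ) (y : Fin d → ℤ) :
    rdotZ (t • μ) y = t * rdotZ μ y := by
  simp [rdotZ, Finset.mul_sum, mul_assoc]

lemma rdotZ_neg (μ : Fin d → ℝ) (y : Fin d → ℤ) : rdotZ (-μ) y = -rdotZ μ y := by
  simp [rdotZ]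

lemma rdotZ_sub (μ ν : Fin d → ℝ) (y : Fin d → ℤ) : rdotZ (μ - ν) y = rdotZ μ y - rdotZ ν y := by
  rw [sub_eq_add_neg, rdotZ_add, rdotZ_neg, sub_eq_add_neg]

lemma rdotZ_zero (y : Fin d → ℤ) : rdotZ (0 : Fin d → ℝ) y = 0 := by
  simp [rdotZ]

lemma rdotZ_add_right (μ : Fin d → ℝ) (x y : Fin d → ℤ) :
    rdotZ μ (x + y) = rdotZ μ x + rdotZ μ y := by
  simp [rdotZ, mul_add, Finset.sum_add_distrib]

lemma rdotZ_neg_right (μ : Fin d → ℝ) (y : Fin d → ℤ) : rdotZ μ (-y) = -rdotZ μ y := by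
  simp [rdotZ]

lemma enormR_nonneg (k : Fin d → ℝ) : 0 ≤ enormR k := Real.sqrt_nonneg _

lemma enormR_sq (k : Fin d → ℝ) : enormR k ^ 2 = ∑ i, k i ^ 2 :=
  Real.sq_sqrt (Finset.sum_nonneg fun _ _ => sq_nonneg _)

lemma enormZ_nonneg (y : Fin d → ℤ) : 0 ≤ enormZ y := Real.sqrt_nonneg _

lemma enormZ_sq (y : Fin d → ℤ) : enormZ y ^ 2 = ∑ i, (y i : ℝ) ^ 2 :=
  Real.sq_sqrt (Finset.sum_nonneg fun _ _ => sq_nonneg _)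

lemma rdot_self (k : Fin d → ℝ) : rdot k k = enormR k ^ 2 := by
  rw [enormR_sq]
  exact Finset.sum_congr rfl fun i _ => by ring

lemma enormR_pos {k : Fin d → ℝ} (hk : k ≠ 0) : 0 < enormR k := by
  obtain ⟨i, hi⟩ := Function.ne_iff.mp hk
  refine Real.sqrt_pos.mpr (Finset.sum_pos' (fun _ _ => sq_nonneg _) ⟨i, Finset.mem_univ _, ?_⟩)
  exact sq_pos_of_ne_zero hi

lemma enormR_smul (t : ℝ) (k : Fin d → ℝ) : enormR (t • k) ^ 2 = t ^ 2 * enormR k ^ 2 := by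
  simp [enormR_sq, Finset.mul_sum, mul_pow]

lemma rdot_comm (a b : Fin d → ℝ) : rdot a b = rdot b a :=
  Finset.sum_congr rfl fun _ _ => mul_comm _ _

lemma rdot_add (a b c : Fin d → ℝ) : rdot a (b + c) = rdot a b + rdot a c := by
  simp [rdot, mul_add, Finset.sum_add_distrib]

lemma rdot_sub (a b c : Fin d → ℝ) : rdot a (b - c) = rdot a b - rdot a c := by
  simp [rdot, mul_sub, Finset.sum_sub_distrib]

lemma rdot_neg (a b : Fin d → ℝ) : rdot a (-b) = -rdot a b := by
  simp [rdot]

lemma rdot_smul (t : ℝ) (a b : Fin d → ℝ) : rdot a (t • b) = t * rdot a b := by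
  simp only [rdot, Finset.mul_sum, Pi.smul_apply, smul_eq_mul]
  exact Finset.sum_congr rfl fun _ _ => by ring

lemma abs_rdot_le (a b : Fin d → ℝ) : |rdot a b| ≤ enormR a * enormR b := by
  refine abs_le_of_sq_le_sq ?_ (mul_nonneg (enormR_nonneg _) (enormR_nonneg _))
  rw [mul_pow, enormR_sq, enormR_sq]
  exact Finset.sum_mul_sq_le_sq_mul_sq _ _ _

lemma abs_rdotZ_le (k : Fin d → ℝ) (y : Fin d → ℤ) : |rdotZ k y| ≤ enormR k * enormZ y := by
  refine abs_le_of_sq_le_sq ?_ (mul_nonneg (enormR_nonneg _) (enormZ_nonneg _))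
  rw [mul_pow, enormR_sq, enormZ_sq]
  exact Finset.sum_mul_sq_le_sq_mul_sq _ _ _

lemma rdotZ_sq_le (k : Fin d → ℝ) (y : Fin d → ℤ) :
    rdotZ k y ^ 2 ≤ enormR k ^ 2 * enormZ y ^ 2 := by
  rw [← mul_pow, ← sq_abs]
  exact pow_le_pow_left₀ (abs_nonneg _) (abs_rdotZ_le k y) 2

lemma exp_mul_le_exp_add_one (b : ℝ) {t : ℝ} (h0 : 0 ≤ t) (h1 : t ≤ 1) :
    Real.exp (t * b) ≤ Real.exp b + 1 := by
  rcases le_total 0 b with hb | hb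
  · have := Real.exp_le_exp.mpr (show t * b ≤ b by nlinarith)
    linarith
  · have := Real.exp_le_one_iff.mpr (show t * b ≤ 0 by nlinarith)
    linarith [Real.exp_pos b]

lemma exp_rdotZ_lineMap_le (μ ν : Fin d → ℝ) (y : Fin d → ℤ) {t : ℝ} (h0 : 0 ≤ t) (h1 : t ≤ 1) :
    Real.exp (rdotZ (μ + t • (ν - μ)) y) ≤ Real.exp (rdotZ μ y) + Real.exp (rdotZ ν y) := by
  rw [rdotZ_add, rdotZ_smul, Real.exp_add]
  have h := exp_mul_le_exp_add_one (rdotZ (ν - μ) y) h0 h1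
  have h2 : Real.exp (rdotZ ν y) = Real.exp (rdotZ μ y) * Real.exp (rdotZ (ν - μ) y) := by
    rw [← Real.exp_add, rdotZ_sub]; ring_nf
  rw [h2]
  nlinarith [Real.exp_pos (rdotZ μ y)]

lemma exp_sub_one_sub_le (b : ℝ) : Real.exp b - 1 - b ≤ b ^ 2 * (1 + Real.exp b) := by
  have h1 := Real.add_one_le_exp (-b)
  have h2 := Real.add_one_le_exp b
  have h3 : Real.exp b * Real.exp (-b) = 1 := by rw [← Real.exp_add]; simp
  have hp := Real.exp_pos b
  have h4 : Real.exp b - 1 ≤ b * Real.exp b := by nlinarith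
  rcases le_total 0 b with hb | hb
  · nlinarith
  · nlinarith

lemma abs_exp_sub_exp_neg_le (b : ℝ) :
    |Real.exp b - Real.exp (-b)| ≤ 2 * |b| * (Real.exp b + Real.exp (-b)) := by
  have h1 := Real.add_one_le_exp (-b)
  have h2 := Real.add_one_le_exp b
  have h3 : Real.exp b * Real.exp (-b) = 1 := by rw [← Real.exp_add]; simp
  have hp := Real.exp_pos b
  have hq := Real.exp_pos (-b)
  have h4 : Real.exp b - 1 ≤ b * Real.exp b := by nlinarith
  have h5 : Real.exp (-b) - 1 ≤ -b * Real.exp (-b) := by nlinarith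
  rw [abs_le]
  rcases le_total 0 b with hb | hb
  · have h6 : 1 ≤ Real.exp b := Real.one_le_exp hb
    rw [abs_of_nonneg hb]
    constructor <;> nlinarith
  · have h6 : 1 ≤ Real.exp (-b) := Real.one_le_exp (by linarith)
    rw [abs_of_nonpos hb]
    constructor <;> nlinarith

lemma integral_exp_remainder (b : ℝ) :
    ∫ t in (0 : ℝ)..1, (1 - t) * (b ^ 2 * Real.exp (t * b)) = Real.exp b - 1 - b := by
  have key : ∀ t ∈ Set.uIcc (0 : ℝ) 1,
      HasDerivAt (fun t : ℝ => (1 - t) * b * Real.exp (t * b) + Real.exp (t * b))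
        ((1 - t) * (b ^ 2 * Real.exp (t * b))) t := by
    intro t _
    have h1 : HasDerivAt (fun t : ℝ => Real.exp (t * b)) (Real.exp (t * b) * (1 * b)) t :=
      ((hasDerivAt_id t).mul_const b).exp
    have h2 : HasDerivAt (fun t : ℝ => (1 - t) * b) (-1 * b) t :=
      ((hasDerivAt_id t).const_sub 1).mul_const b
    exact ((h2.mul h1).add h1).congr_deriv (by ring)
  rw [intervalIntegral.integral_eq_sub_of_hasDerivAt key
    (Continuous.intervalIntegrable (by fun_prop) _ _)]
  simp
  ring

lemma abs_coord_le_enormZ (y : Fin d → ℤ) (j : Fin d) : |(y j : ℝ)| ≤ enormZ y := by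
  refine abs_le_of_sq_le_sq ?_ (enormZ_nonneg _)
  rw [enormZ_sq]
  exact Finset.single_le_sum (f := fun i => (y i : ℝ) ^ 2) (fun _ _ => sq_nonneg _)
    (Finset.mem_univ j)

lemma exp_rdotZ_sub_mul (μ ν : Fin d → ℝ) (y : Fin d → ℤ) :
    Real.exp (rdotZ μ y) * Real.exp (rdotZ (ν - μ) y) = Real.exp (rdotZ ν y) := by
  rw [← Real.exp_add, rdotZ_sub]; ring_nf

/-- Moment bounds for the tilted kernel at `μ`, together with a lower bound on its covariance. -/
structure TiltControl (J : (Fin d → ℤ) → ℝ) (M K : ℝ) (μ : Fin d → ℝ) : Prop where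
  summable_abs : Summable fun y => |J y| * Real.exp (rdotZ μ y)
  tsum_abs_le : ∑' y, |J y| * Real.exp (rdotZ μ y) ≤ M
  summable_sq : Summable fun y => enormZ y ^ 2 * (|J y| * Real.exp (rdotZ μ y))
  tsum_sq_le : ∑' y, enormZ y ^ 2 * (|J y| * Real.exp (rdotZ μ y)) ≤ M
  covariance_lower : ∀ k, 2 * K * enormR k ^ 2 ≤
    ∑' y, rdotZ k y ^ 2 * (J y * Real.exp (rdotZ μ y))

namespace TiltControl

variable {J : (Fin d → ℤ) → ℝ} {M K : ℝ} {μ ν : Fin d → ℝ}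

lemma summable_zeroth (h : TiltControl J M K μ) :
    Summable fun y => J y * Real.exp (rdotZ μ y) :=
  h.summable_abs.of_norm_bounded fun y => by simp

/-- A weight of at most quadratic growth can be summed against the tilted kernel. -/
lemma summable_weight (h : TiltControl J M K μ) {w : (Fin d → ℤ) → ℝ} {A B : ℝ}
    (hw : ∀ y, |w y| ≤ A + B * enormZ y ^ 2) :
    Summable fun y => w y * (J y * Real.exp (rdotZ μ y)) := by
  refine ((h.summable_abs.mul_left A).add (h.summable_sq.mul_left B)).of_norm_bounded fun y => ?_
  rw [norm_mul, norm_mul, Real.norm_eq_abs, Real.norm_eq_abs, Real.norm_eq_abs, Real.abs_exp]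
  have := mul_le_mul_of_nonneg_right (hw y) (mul_nonneg (abs_nonneg (J y))
    (Real.exp_pos (rdotZ μ y)).le)
  linarith

lemma summable_second (h : TiltControl J M K μ) (k : Fin d → ℝ) :
    Summable fun y => rdotZ k y ^ 2 * (J y * Real.exp (rdotZ μ y)) :=
  h.summable_weight (A := 0) (B := enormR k ^ 2) fun y => by
    rw [abs_of_nonneg (sq_nonneg _), zero_add]
    exact rdotZ_sq_le k y

lemma summable_first (h : TiltControl J M K μ) (k : Fin d → ℝ) :
    Summable fun y => rdotZ k y * (J y * Real.exp (rdotZ μ y)) :=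
  h.summable_weight (A := 1) (B := enormR k ^ 2) fun y => by
    have := rdotZ_sq_le k y
    rw [← sq_abs] at this
    nlinarith [sq_nonneg (|rdotZ k y| - 1)]

lemma rdot_etaOf (h : TiltControl J M K μ) (k : Fin d → ℝ) :
    rdot (etaOf J μ) k = ∑' y, rdotZ k y * (J y * Real.exp (rdotZ μ y)) := by
  have hs : ∀ j : Fin d, Summable fun y : Fin d → ℤ =>
      (k j * (y j : ℝ)) * (J y * Real.exp (rdotZ μ y)) := fun j => by
    have := (h.summable_weight (A := 1) (B := 1) (w := fun y => (y j : ℝ)) fun y => by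
      nlinarith [abs_coord_le_enormZ y j, sq_nonneg (enormZ y - 1)]).mul_left (k j)
    simpa only [mul_assoc] using this
  calc rdot (etaOf J μ) k
      = ∑ j, ∑' y : Fin d → ℤ, (k j * (y j : ℝ)) * (J y * Real.exp (rdotZ μ y)) := by
        refine Finset.sum_congr rfl fun j _ => ?_
        rw [etaOf, ← tsum_mul_right]
        exact tsum_congr fun y => by ring
    _ = _ := by
        rw [← Summable.tsum_finsetSum fun j _ => hs j]
        exact tsum_congr fun y => (Finset.sum_mul _ _ _).symm

lemma rdot_LambdaOf (h : TiltControl J M K μ) (k : Fin d → ℝ) :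
    rdot k (LambdaOf J μ *ᵥ k) = ∑' y, rdotZ k y ^ 2 * (J y * Real.exp (rdotZ μ y)) := by
  have hs : ∀ j l : Fin d, Summable fun y : Fin d → ℤ =>
      (k j * (y j : ℝ)) * (k l * (y l : ℝ)) * (J y * Real.exp (rdotZ μ y)) := fun j l => by
    have := (h.summable_weight (A := 0) (B := 1) (w := fun y => (y j : ℝ) * (y l : ℝ))
      fun y => by
        rw [abs_mul]
        nlinarith [abs_coord_le_enormZ y j, abs_coord_le_enormZ y l, abs_nonneg (y j : ℝ),
          abs_nonneg (y l : ℝ)]).mul_left (k j * k l)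
    exact this.congr fun y => by ring
  calc rdot k (LambdaOf J μ *ᵥ k)
      = ∑ j, ∑ l, ∑' y : Fin d → ℤ,
          (k j * (y j : ℝ)) * (k l * (y l : ℝ)) * (J y * Real.exp (rdotZ μ y)) := by
        refine Finset.sum_congr rfl fun j _ => ?_
        rw [Matrix.mulVec, dotProduct, Finset.mul_sum]
        refine Finset.sum_congr rfl fun l _ => ?_
        rw [LambdaOf, Matrix.of_apply, ← tsum_mul_right, ← tsum_mul_left]
        exact tsum_congr fun y => by ring
    _ = _ := by
        simp_rw [← Summable.tsum_finsetSum fun l _ => hs _ l]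
        rw [← Summable.tsum_finsetSum fun j _ => summable_sum fun l _ => hs j l]
        refine tsum_congr fun y => ?_
        simp_rw [← Finset.sum_mul, ← Finset.mul_sum, ← Finset.sum_mul, sq]
        rfl

lemma covariance_upper (h : TiltControl J M K μ) (k : Fin d → ℝ) :
    ∑' y, rdotZ k y ^ 2 * (J y * Real.exp (rdotZ μ y)) ≤ M * enormR k ^ 2 := by
  have hle : ∀ y, rdotZ k y ^ 2 * (J y * Real.exp (rdotZ μ y)) ≤
      enormR k ^ 2 * (enormZ y ^ 2 * (|J y| * Real.exp (rdotZ μ y))) := fun y => by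
    have h1 : J y * Real.exp (rdotZ μ y) ≤ |J y| * Real.exp (rdotZ μ y) :=
      mul_le_mul_of_nonneg_right (le_abs_self _) (Real.exp_pos _).le
    have h2 : 0 ≤ |J y| * Real.exp (rdotZ μ y) := by positivity
    nlinarith [rdotZ_sq_le k y, sq_nonneg (rdotZ k y)]
  refine ((h.summable_second k).tsum_le_tsum hle (h.summable_sq.mul_left _)).trans ?_
  rw [tsum_mul_left, mul_comm]
  exact mul_le_mul_of_nonneg_right h.tsum_sq_le (sq_nonneg _)

lemma hasSum_remainder (hμ : TiltControl J M K μ) (hν : TiltControl J M K ν) :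
    HasSum (fun y => J y * Real.exp (rdotZ μ y) *
        (Real.exp (rdotZ (ν - μ) y) - 1 - rdotZ (ν - μ) y))
      (tiltSum J ν - tiltSum J μ - rdot (etaOf J μ) (ν - μ)) := by
  rw [hμ.rdot_etaOf]
  refine ((hν.summable_zeroth.hasSum.sub hμ.summable_zeroth.hasSum).sub
    (hμ.summable_first (ν - μ)).hasSum).congr_fun ?_
  intro y
  rw [← exp_rdotZ_sub_mul μ ν y]
  ring

lemma tiltSum_le (hμ : TiltControl J M K μ) (hν : TiltControl J M K ν) :
    |tiltSum J ν - tiltSum J μ - rdot (etaOf J μ) (ν - μ)| ≤ 2 * M * enormR (ν - μ) ^ 2 := by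
  rw [← (hasSum_remainder hμ hν).tsum_eq]
  have hle : ∀ y, ‖J y * Real.exp (rdotZ μ y) *
        (Real.exp (rdotZ (ν - μ) y) - 1 - rdotZ (ν - μ) y)‖ ≤
      enormR (ν - μ) ^ 2 * (enormZ y ^ 2 * (|J y| * Real.exp (rdotZ μ y)) +
        enormZ y ^ 2 * (|J y| * Real.exp (rdotZ ν y))) := fun y => by
    have h0 : 0 ≤ Real.exp (rdotZ (ν - μ) y) - 1 - rdotZ (ν - μ) y := by
      linarith [Real.add_one_le_exp (rdotZ (ν - μ) y)]
    have h1 := exp_sub_one_sub_le (rdotZ (ν - μ) y)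
    have h2 := rdotZ_sq_le (ν - μ) y
    rw [norm_mul, norm_mul, Real.norm_eq_abs, Real.norm_eq_abs, Real.norm_eq_abs, Real.abs_exp,
      abs_of_nonneg h0, ← exp_rdotZ_sub_mul μ ν y]
    have h3 : 0 ≤ |J y| * Real.exp (rdotZ μ y) := by positivity
    have h4 := Real.exp_pos (rdotZ (ν - μ) y)
    calc _ ≤ |J y| * Real.exp (rdotZ μ y) *
          (enormR (ν - μ) ^ 2 * enormZ y ^ 2 * (1 + Real.exp (rdotZ (ν - μ) y))) := by
          refine mul_le_mul_of_nonneg_left (h1.trans ?_) h3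
          exact mul_le_mul_of_nonneg_right h2 (by linarith)
      _ = _ := by ring
  have hs := (hμ.summable_sq.add hν.summable_sq).mul_left (enormR (ν - μ) ^ 2)
  refine (tsum_of_norm_bounded hs.hasSum hle).trans ?_
  rw [tsum_mul_left, hμ.summable_sq.tsum_add hν.summable_sq]
  nlinarith [hμ.tsum_sq_le, hν.tsum_sq_le, sq_nonneg (enormR (ν - μ))]

lemma tiltSum_ge (hμ : TiltControl J M K μ) (hν : TiltControl J M K ν)
    (hseg : ∀ t : ℝ, 0 ≤ t → t ≤ 1 → TiltControl J M K (μ + t • (ν - μ))) :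
    tiltSum J μ + rdot (etaOf J μ) (ν - μ) + K * enormR (ν - μ) ^ 2 ≤ tiltSum J ν := by
  set δ := ν - μ with hδ
  have hexp : ∀ (t : ℝ) y, Real.exp (rdotZ (μ + t • δ) y) =
      Real.exp (rdotZ μ y) * Real.exp (t * rdotZ δ y) := fun t y => by
    rw [rdotZ_add, rdotZ_smul, Real.exp_add]
  have hI : ∀ t ∈ Set.uIoc (0 : ℝ) 1, 0 ≤ t ∧ t ≤ 1 := fun t ht => by
    rw [Set.uIoc_of_le zero_le_one] at ht
    exact ⟨ht.1.le, ht.2⟩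
  set F : (Fin d → ℤ) → ℝ → ℝ := fun y t =>
    (1 - t) * (rdotZ δ y ^ 2 * (J y * Real.exp (rdotZ (μ + t • δ) y))) with hF
  set G : ℝ → ℝ := fun t =>
    (1 - t) * ∑' y, rdotZ δ y ^ 2 * (J y * Real.exp (rdotZ (μ + t • δ) y)) with hG
  set b : (Fin d → ℤ) → ℝ := fun y =>
    enormR δ ^ 2 * (enormZ y ^ 2 * (|J y| * Real.exp (rdotZ μ y)) +
        enormZ y ^ 2 * (|J y| * Real.exp (rdotZ ν y))) with hb
  have hbs : Summable b := (hμ.summable_sq.add hν.summable_sq).mul_left (enormR δ ^ 2)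
  have hFcont : ∀ y, Continuous (F y) := fun y => by
    simp only [hF, hexp]
    fun_prop
  have hFb : ∀ y t, 0 ≤ t → t ≤ 1 → ‖F y t‖ ≤ b y := fun y t h0 h1 => by
    simp only [hF, hb]
    rw [norm_mul, norm_mul, norm_mul, Real.norm_eq_abs, Real.norm_eq_abs, Real.norm_eq_abs,
      Real.norm_eq_abs, Real.abs_exp, abs_of_nonneg (sub_nonneg.mpr h1),
      abs_of_nonneg (sq_nonneg (rdotZ δ y))]
    have h2 := exp_rdotZ_lineMap_le μ ν y h0 h1
    calc (1 - t) * (rdotZ δ y ^ 2 * (|J y| * Real.exp (rdotZ (μ + t • δ) y)))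
        ≤ 1 * ((enormR δ ^ 2 * enormZ y ^ 2) *
          (|J y| * (Real.exp (rdotZ μ y) + Real.exp (rdotZ ν y)))) := by
          have := rdotZ_sq_le δ y
          gcongr
          linarith
      _ = _ := by ring
  have hsum : ∀ t, 0 ≤ t → t ≤ 1 → HasSum (fun y => F y t) (G t) := fun t h0 h1 =>
    ((hseg t h0 h1).summable_second δ).hasSum.mul_left (1 - t)
  have hint : HasSum (fun y => ∫ t in (0 : ℝ)..1, F y t) (∫ t in (0 : ℝ)..1, G t) := by
    refine intervalIntegral.hasSum_integral_of_dominated_convergence (fun y _ => b y)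
      (fun y => (hFcont y).aestronglyMeasurable) ?_ ?_ ?_ ?_
    · exact fun y => Eventually.of_forall fun t ht => hFb y t (hI t ht).1 (hI t ht).2
    · exact Eventually.of_forall fun t _ => hbs
    · exact intervalIntegrable_const
    · exact Eventually.of_forall fun t ht => hsum t (hI t ht).1 (hI t ht).2
  have hrem : (fun y => ∫ t in (0 : ℝ)..1, F y t) = fun y => J y * Real.exp (rdotZ μ y) *
        (Real.exp (rdotZ δ y) - 1 - rdotZ δ y) := by
    funext y
    rw [← integral_exp_remainder, ← intervalIntegral.integral_const_mul]
    refine intervalIntegral.integral_congr fun t _ => ?_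
    simp only [hF, hexp]
    ring
  rw [hrem] at hint
  have heq := hint.unique (hasSum_remainder hμ hν)
  have hGcont : ContinuousOn G (Set.Icc 0 1) := by
    refine (continuousOn_tsum (fun y => (hFcont y).continuousOn) hbs
      fun y t ht => hFb y t ht.1 ht.2).congr fun t ht => ?_
    exact (hsum t ht.1 ht.2).tsum_eq.symm
  have hlow : ∫ t in (0 : ℝ)..1, (1 - t) * (2 * K * enormR δ ^ 2) ≤ ∫ t in (0 : ℝ)..1, G t := by
    refine intervalIntegral.integral_mono_on zero_le_one
      (Continuous.intervalIntegrable (by fun_prop) _ _)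
      (ContinuousOn.intervalIntegrable (by rwa [Set.uIcc_of_le zero_le_one])) fun t ht => ?_
    exact mul_le_mul_of_nonneg_left ((hseg t ht.1 ht.2).covariance_lower δ) (by linarith [ht.2])
  have hval : ∫ t in (0 : ℝ)..1, (1 - t) * (2 * K * enormR δ ^ 2) = K * enormR δ ^ 2 := by
    rw [intervalIntegral.integral_mul_const, intervalIntegral.integral_sub (by simp) (by simp)]
    simp
    ring
  rw [hval, heq] at hlow
  linarith

end TiltControl

lemma summable_of_lpNorm_one_le {f : (Fin d → ℤ) → ℝ} {M : ℝ} (hM : 0 ≤ M)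
    (h : lpNorm f 1 ≤ ENNReal.ofReal M) : (Summable fun y => |f y|) ∧ ∑' y, |f y| ≤ M := by
  simp only [lpNorm, Real.rpow_one, div_one, ENNReal.rpow_one] at h
  have hs : Summable fun y => |f y| := by
    refine (ENNReal.summable_toReal (h.trans_lt ENNReal.ofReal_lt_top).ne).congr fun y => ?_
    rw [ENNReal.toReal_ofReal (abs_nonneg _)]
  refine ⟨hs, ?_⟩
  rwa [← ENNReal.ofReal_tsum_of_nonneg (fun _ => abs_nonneg _) hs,
    ENNReal.ofReal_le_ofReal_iff hM] at h

lemma fourierZ_re {Q : (Fin d → ℤ) → ℝ} (hQ : Summable fun y => |Q y|) (k : Fin d → ℝ) :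
    HasSum (fun y => Q y * Real.cos (rdotZ k y)) (fourierZ Q k).re := by
  have hn : ∀ y, ‖(Q y : ℂ) * Complex.exp (-Complex.I * (rdotZ k y : ℂ))‖ ≤ |Q y| := fun y => by
    have : -Complex.I * (rdotZ k y : ℂ) = ((-rdotZ k y : ℝ) : ℂ) * Complex.I := by
      push_cast; ring
    rw [norm_mul, this, Complex.norm_exp_ofReal_mul_I, Complex.norm_real, mul_one,
      Real.norm_eq_abs]
  refine (Complex.hasSum_re (hQ.of_norm_bounded hn).hasSum).congr_fun fun y => ?_
  have : -Complex.I * (rdotZ k y : ℂ) = ((-rdotZ k y : ℝ) : ℂ) * Complex.I := by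
    push_cast; ring
  rw [Complex.re_ofReal_mul, this, Complex.exp_ofReal_mul_I_re, Real.cos_neg]

lemma tendsto_one_sub_cos_div_sq (a : ℝ) :
    Tendsto (fun t : ℝ => (1 - Real.cos (t * a)) / t ^ 2) (𝓝[≠] 0) (𝓝 (a ^ 2 / 2)) := by
  have h : HasDerivAt (fun t : ℝ => Real.sin (t * (a / 2))) (a / 2) 0 := by
    have := ((hasDerivAt_id (0 : ℝ)).mul_const (a / 2)).sin
    simpa using this
  have h2 := ((hasDerivAt_iff_tendsto_slope_zero.mp h).pow 2).const_mul 2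
  refine (h2.congr fun t => ?_).trans_eq (by ring_nf)
  have : t * a = 2 * (t * (a / 2)) := by ring
  rw [this, Real.cos_two_mul, Real.cos_sq']
  simp [mul_pow]
  ring

lemma covariance_lower_of_infrared {Q : (Fin d → ℤ) → ℝ} {K : ℝ}
    (hQ : Summable fun y => |Q y|) (hQ2 : Summable fun y => enormZ y ^ 2 * |Q y|)
    (hinf : ∀ k : Fin d → ℝ, (∀ i, |k i| ≤ π) →
      K * enormR k ^ 2 ≤ (fourierZ Q 0 - fourierZ Q k).re) (k : Fin d → ℝ) :
    2 * K * enormR k ^ 2 ≤ ∑' y, rdotZ k y ^ 2 * Q y := by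
  have hlim : Tendsto (fun t : ℝ => ∑' y, Q y * ((1 - Real.cos (t * rdotZ k y)) / t ^ 2))
      (𝓝[≠] 0) (𝓝 (∑' y, Q y * (rdotZ k y ^ 2 / 2))) := by
    refine tendsto_tsum_of_dominated_convergence (hQ2.mul_left (enormR k ^ 2))
      (fun y => (tendsto_one_sub_cos_div_sq _).const_mul _) ?_
    filter_upwards [self_mem_nhdsWithin] with t ht y
    have ht2 : 0 < t ^ 2 := sq_pos_of_ne_zero ht
    have h0 : 0 ≤ (1 - Real.cos (t * rdotZ k y)) / t ^ 2 :=
      div_nonneg (by linarith [Real.cos_le_one (t * rdotZ k y)]) ht2.le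
    have h1 : (1 - Real.cos (t * rdotZ k y)) / t ^ 2 ≤ enormR k ^ 2 * enormZ y ^ 2 := by
      rw [div_le_iff₀ ht2]
      have := Real.one_sub_sq_div_two_le_cos (x := t * rdotZ k y)
      nlinarith [rdotZ_sq_le k y, sq_nonneg (rdotZ k y)]
    rw [norm_mul, Real.norm_eq_abs, Real.norm_eq_abs, abs_of_nonneg h0]
    nlinarith [abs_nonneg (Q y)]
  have hsmall : ∀ᶠ t : ℝ in 𝓝[≠] 0, ∀ i, |(t • k) i| ≤ π := by
    refine nhdsWithin_le_nhds (eventually_all.mpr fun i => ?_)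
    have hc : Continuous fun t : ℝ => |(t • k) i| := by
      simp only [Pi.smul_apply, smul_eq_mul]; fun_prop
    refine (hc.tendsto 0).eventually (ge_mem_nhds ?_)
    simpa using Real.pi_pos
  have hge : K * enormR k ^ 2 ≤ ∑' y, Q y * (rdotZ k y ^ 2 / 2) := by
    refine ge_of_tendsto hlim ?_
    filter_upwards [hsmall, self_mem_nhdsWithin] with t hk ht
    have ht2 : 0 < t ^ 2 := sq_pos_of_ne_zero ht
    have h1 := hinf _ hk
    have h2 := ((fourierZ_re hQ 0).sub (fourierZ_re hQ (t • k))).div_const (t ^ 2)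
    have h3 : ∑' y, Q y * ((1 - Real.cos (t * rdotZ k y)) / t ^ 2) =
        (fourierZ Q 0 - fourierZ Q (t • k)).re / t ^ 2 := by
      rw [Complex.sub_re, ← h2.tsum_eq]
      refine tsum_congr fun y => ?_
      rw [rdotZ_zero, rdotZ_smul, Real.cos_zero]
      ring
    rw [h3, le_div_iff₀ ht2]
    rw [enormR_smul] at h1
    linarith
  have : ∑' y, rdotZ k y ^ 2 * Q y = 2 * ∑' y, Q y * (rdotZ k y ^ 2 / 2) := by
    rw [← tsum_mul_left]
    exact tsum_congr fun y => by ring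
  rw [this]
  linarith

lemma enormZ_sq_le_rpow (y : Fin d → ℤ) {ζ : ℝ} (hζ : 0 < ζ) :
    enormZ y ^ 2 ≤ enormZ y ^ (2 + ζ) := by
  by_cases hy : y = 0
  · subst hy
    simp [enormZ, Real.zero_rpow (by linarith : (2 + ζ) ≠ 0)]
  · have h1 : 1 ≤ enormZ y := by
      obtain ⟨i, hi⟩ := Function.ne_iff.mp hy
      refine le_trans ?_ (abs_coord_le_enormZ y i)
      exact_mod_cast Int.one_le_abs hi
    rw [← Real.rpow_natCast]
    exact Real.rpow_le_rpow_of_exponent_le h1 (by norm_num; exact hζ.le)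

lemma MemQweak.tiltControl {J g : (Fin d → ℤ) → ℝ} {M K ζ : ℝ} {μ : Fin d → ℝ} (hM : 0 ≤ M)
    (hζ : 0 < ζ) (h : MemQweak M K ζ (tilt J μ) g) : TiltControl J M K μ := by
  have habs : ∀ y, |tilt J μ y| = |J y| * Real.exp (rdotZ μ y) := fun y => by
    rw [tilt, abs_mul, Real.abs_exp]
  obtain ⟨h1, h2⟩ := summable_of_lpNorm_one_le hM h.Q_l1
  obtain ⟨h3, h4⟩ := summable_of_lpNorm_one_le hM h.Q_moment
  have hle : ∀ y, enormZ y ^ 2 * |tilt J μ y| ≤ |enormZ y ^ (2 + ζ) * tilt J μ y| := fun y => by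
    rw [abs_mul]
    refine mul_le_mul_of_nonneg_right ?_ (abs_nonneg _)
    exact (enormZ_sq_le_rpow y hζ).trans (le_abs_self _)
  have h5 : Summable fun y => enormZ y ^ 2 * |tilt J μ y| :=
    h3.of_nonneg_of_le (fun y => by positivity) hle
  have h6 := (h5.tsum_le_tsum hle h3).trans h4
  have h7 := covariance_lower_of_infrared h1 h5 h.infrared
  simp only [habs] at h1 h2 h5 h6
  exact ⟨h1, h2, h5, h6, h7⟩

lemma tsum_conv {f g : (Fin d → ℤ) → ℝ} (hf : Summable f) (hg : Summable g) :
    ∑' x, conv f g x = (∑' x, f x) * ∑' x, g x := by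
  let e : (Fin d → ℤ) × (Fin d → ℤ) ≃ (Fin d → ℤ) × (Fin d → ℤ) :=
    ⟨fun p => (p.1 - p.2, p.2), fun p => (p.1 + p.2, p.2), fun p => by simp, fun p => by simp⟩
  have hs := summable_mul_of_summable_norm hf.norm hg.norm
  rw [tsum_mul_tsum_of_summable_norm hf.norm hg.norm, ← e.tsum_eq]
  exact ((e.summable_iff.mpr hs).tsum_prod).symm

lemma conv_tilt (f g : (Fin d → ℤ) → ℝ) (μ : Fin d → ℝ) (x : Fin d → ℤ) :
    conv (tilt f μ) (tilt g μ) x = conv f g x * Real.exp (rdotZ μ x) := by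
  rw [conv, conv, ← tsum_mul_right]
  refine tsum_congr fun y => ?_
  have : rdotZ μ x = rdotZ μ (x - y) + rdotZ μ y := by
    rw [← rdotZ_add_right, sub_add_cancel]
  rw [this, Real.exp_add, tilt, tilt]
  ring

lemma mem_Omega_iff {S : (Fin d → ℤ) → ℝ} (hS : ∀ x, 0 ≤ S x) {μ : Fin d → ℝ} :
    μ ∈ Omega S ↔ Summable fun x => S x * Real.exp (rdotZ μ x) := by
  have h0 : ∀ x, 0 ≤ S x * Real.exp (rdotZ μ x) := fun x =>
    mul_nonneg (hS x) (Real.exp_pos _).le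
  constructor
  · intro h
    refine (ENNReal.summable_toReal (ne_of_lt h)).congr fun x => ?_
    rw [ENNReal.toReal_ofReal (h0 x)]
  · intro h
    change chi S μ < ⊤
    rw [chi, ← ENNReal.ofReal_tsum_of_nonneg h0 h]
    exact ENNReal.ofReal_lt_top

lemma convex_Omega {S : (Fin d → ℤ) → ℝ} (hS : ∀ x, 0 ≤ S x) : Convex ℝ (Omega S) := by
  intro μ hμ ν hν a b ha hb hab
  rw [mem_Omega_iff hS] at hμ hν ⊢
  refine (hμ.add hν).of_nonneg_of_le (fun x => mul_nonneg (hS x) (Real.exp_pos _).le) fun x => ?_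
  have h := exp_rdotZ_lineMap_le μ ν x hb (by linarith)
  have heq : a • μ + b • ν = μ + b • (ν - μ) := by
    rw [← eq_sub_iff_add_eq] at hab
    rw [hab]; module
  rw [heq, ← mul_add]
  exact mul_le_mul_of_nonneg_left h (hS x)

lemma perm_mem_Omega {S : (Fin d → ℤ) → ℝ} (hS : ∀ x, 0 ≤ S x) (hsym : ZdSymmetric S)
    (σ : Equiv.Perm (Fin d)) {μ : Fin d → ℝ} (hμ : μ ∈ Omega S) :
    (fun i => μ (σ i)) ∈ Omega S := by
  rw [mem_Omega_iff hS] at hμ ⊢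
  let e : (Fin d → ℤ) ≃ (Fin d → ℤ) := Equiv.arrowCongr σ (Equiv.refl ℤ)
  refine (e.summable_iff.mpr hμ).congr fun x => ?_
  have h1 : S (e x) = S x := hsym.1 σ.symm x
  have h2 : rdotZ μ (e x) = rdotZ (fun i => μ (σ i)) x := by
    rw [rdotZ, ← Equiv.sum_comp σ]
    simp [rdotZ, e]
  simp only [Function.comp_apply, h1, h2]

lemma flip_mem_Omega {S : (Fin d → ℤ) → ℝ} (hS : ∀ x, 0 ≤ S x) (hsym : ZdSymmetric S)
    (ε : Fin d → Bool) {μ : Fin d → ℝ} (hμ : μ ∈ Omega S) :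
    (fun i => if ε i then -μ i else μ i) ∈ Omega S := by
  rw [mem_Omega_iff hS] at hμ ⊢
  have hinv : Function.Involutive fun (x : Fin d → ℤ) i => if ε i then -x i else x i := by
    intro x; funext i
    by_cases h : ε i <;> simp [h]
  refine ((hinv.toPerm _).summable_iff.mpr hμ).congr fun x => ?_
  have h1 : S (hinv.toPerm _ x) = S x := hsym.2 ε x
  have h2 : rdotZ μ (hinv.toPerm _ x) = rdotZ (fun i => if ε i then -μ i else μ i) x := by
    refine Finset.sum_congr rfl fun i _ => ?_
    by_cases h : ε i <;> simp [h]
  simp only [Function.comp_apply, h1, h2]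

lemma perm_mem_closure_Omega {S : (Fin d → ℤ) → ℝ} (hS : ∀ x, 0 ≤ S x) (hsym : ZdSymmetric S)
    (σ : Equiv.Perm (Fin d)) {μ : Fin d → ℝ} (hμ : μ ∈ closure (Omega S)) :
    (fun i => μ (σ i)) ∈ closure (Omega S) :=
  map_mem_closure (f := fun (μ : Fin d → ℝ) i => μ (σ i)) (by fun_prop) hμ
    fun _ h => perm_mem_Omega hS hsym σ h

lemma flip_mem_closure_Omega {S : (Fin d → ℤ) → ℝ} (hS : ∀ x, 0 ≤ S x) (hsym : ZdSymmetric S)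
    (ε : Fin d → Bool) {μ : Fin d → ℝ} (hμ : μ ∈ closure (Omega S)) :
    (fun i => if ε i then -μ i else μ i) ∈ closure (Omega S) := by
  refine map_mem_closure (f := fun (μ : Fin d → ℝ) i => if ε i then -μ i else μ i) ?_ hμ
    fun _ h => flip_mem_Omega hS hsym ε h
  refine continuous_pi fun i => ?_
  by_cases h : ε i <;> simp only [h, if_true, if_false, Bool.false_eq_true] <;> fun_prop

lemma neg_mem_closure_Omega {S : (Fin d → ℤ) → ℝ} (hS : ∀ x, 0 ≤ S x) (hsym : ZdSymmetric S)
    {μ : Fin d → ℝ} (hμ : μ ∈ closure (Omega S)) : -μ ∈ closure (Omega S) :=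
  flip_mem_closure_Omega hS hsym (fun _ => true) hμ

lemma ZdSymmetric.neg {f : (Fin d → ℤ) → ℝ} (hf : ZdSymmetric f) (y : Fin d → ℤ) :
    f (-y) = f y :=
  hf.2 (fun _ => true) y

lemma tiltSum_neg {J : (Fin d → ℤ) → ℝ} (hJ : ZdSymmetric J) (μ : Fin d → ℝ) :
    tiltSum J (-μ) = tiltSum J μ := by
  rw [tiltSum, tiltSum, ← (Equiv.neg (Fin d → ℤ)).tsum_eq]
  refine tsum_congr fun y => ?_
  rw [Equiv.neg_apply, hJ.neg, rdotZ_neg, rdotZ_neg_right, neg_neg]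

lemma etaOf_neg {J : (Fin d → ℤ) → ℝ} (hJ : ZdSymmetric J) (μ : Fin d → ℝ) :
    etaOf J (-μ) = -etaOf J μ := by
  funext j
  rw [Pi.neg_apply, etaOf, etaOf, ← (Equiv.neg (Fin d → ℤ)).tsum_eq, ← tsum_neg]
  refine tsum_congr fun y => ?_
  rw [Equiv.neg_apply, hJ.neg, rdotZ_neg, rdotZ_neg_right, neg_neg]
  simp

lemma TiltControl.enormR_etaOf_le {J : (Fin d → ℤ) → ℝ} {M K : ℝ} {μ : Fin d → ℝ}
    (hJ : ZdSymmetric J) (h : TiltControl J M K μ) (hneg : TiltControl J M K (-μ)) :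
    enormR (etaOf J μ) ≤ 2 * M * enormR μ := by
  set η := etaOf J μ with hη
  have hs : HasSum (fun y => rdotZ η y * J y * (Real.exp (rdotZ μ y) - Real.exp (-rdotZ μ y)))
      (2 * enormR η ^ 2) := by
    have h1 := (h.summable_first η).hasSum.sub (hneg.summable_first η).hasSum
    rw [← h.rdot_etaOf, ← hneg.rdot_etaOf, etaOf_neg hJ, ← hη, rdot_comm (-η), rdot_neg,
      rdot_self, sub_neg_eq_add, ← two_mul] at h1
    refine h1.congr_fun fun y => ?_
    rw [rdotZ_neg]
    ring
  have hle : ∀ y, ‖rdotZ η y * J y * (Real.exp (rdotZ μ y) - Real.exp (-rdotZ μ y))‖ ≤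
      2 * (enormR η * enormR μ) * (enormZ y ^ 2 * (|J y| * Real.exp (rdotZ μ y)) +
        enormZ y ^ 2 * (|J y| * Real.exp (rdotZ (-μ) y))) := fun y => by
    rw [norm_mul, norm_mul, Real.norm_eq_abs, Real.norm_eq_abs, Real.norm_eq_abs, rdotZ_neg]
    calc _ ≤ (enormR η * enormZ y) * |J y| * (2 * (enormR μ * enormZ y) *
            (Real.exp (rdotZ μ y) + Real.exp (-rdotZ μ y))) := by
          refine mul_le_mul (mul_le_mul_of_nonneg_right (abs_rdotZ_le _ _) (abs_nonneg _))
            ((abs_exp_sub_exp_neg_le _).trans ?_) (abs_nonneg _) ?_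
          · have := abs_rdotZ_le μ y
            gcongr
          · have := enormR_nonneg η
            have := enormZ_nonneg y
            positivity
      _ = _ := by ring
  have hb := (h.summable_sq.add hneg.summable_sq).mul_left (2 * (enormR η * enormR μ))
  have h2 := tsum_of_norm_bounded hb.hasSum hle
  rw [hs.tsum_eq, tsum_mul_left, h.summable_sq.tsum_add hneg.summable_sq, Real.norm_eq_abs,
    abs_of_nonneg (by positivity)] at h2
  have hη0 := enormR_nonneg η
  have hμ0 := enormR_nonneg μ
  have h3 : enormR η * enormR η ≤ enormR η * (2 * M * enormR μ) := by
    have := mul_le_mul_of_nonneg_left (add_le_add h.tsum_sq_le hneg.tsum_sq_le)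
      (mul_nonneg zero_le_two (mul_nonneg hη0 hμ0))
    linarith
  rcases hη0.eq_or_lt with h0 | h0
  · rw [← h0]
    have hM : 0 ≤ M := (tsum_nonneg fun y => by positivity).trans h.tsum_abs_le
    positivity
  · exact le_of_mul_le_mul_left h3 h0

lemma rdot_self_pos {x : Fin d → ℝ} (hx : x ≠ 0) : 0 < rdot x x := by
  rw [rdot_self]
  exact pow_pos (enormR_pos hx) 2

lemma continuous_rdot (x : Fin d → ℝ) : Continuous fun μ : Fin d → ℝ => rdot μ x := by
  unfold rdot; fun_prop

lemma abs_coord_le_enormR (x : Fin d → ℝ) (i : Fin d) : |x i| ≤ enormR x := by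
  refine abs_le_of_sq_le_sq ?_ (enormR_nonneg _)
  rw [enormR_sq]
  exact Finset.single_le_sum (f := fun i => x i ^ 2) (fun _ _ => sq_nonneg _) (Finset.mem_univ i)

lemma enormR_le_sum_abs (x : Fin d → ℝ) : enormR x ≤ ∑ i, |x i| := by
  refine abs_le_of_sq_le_sq' ?_ (Finset.sum_nonneg fun _ _ => abs_nonneg _) |>.2
  rw [enormR_sq, sq (∑ i, |x i|), Finset.sum_mul]
  refine Finset.sum_le_sum fun i hi => ?_
  rw [← sq_abs, sq]
  exact mul_le_mul_of_nonneg_left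
    (Finset.single_le_sum (f := fun i => |x i|) (fun _ _ => abs_nonneg _) hi) (abs_nonneg _)

lemma exists_rdot_lt_of_mem_interior {s : Set (Fin d → ℝ)} {μ x : Fin d → ℝ}
    (hμ : μ ∈ interior s) (hx : x ≠ 0) : ∃ ν ∈ s, rdot μ x < rdot ν x := by
  have hc : Continuous fun t : ℝ => μ + t • x := by fun_prop
  have h0 : ∀ᶠ t in 𝓝[>] (0 : ℝ), μ + t • x ∈ interior s :=
    nhdsWithin_le_nhds ((hc.tendsto 0).eventually (isOpen_interior.mem_nhds (by simpa using hμ)))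
  obtain ⟨t, ht, ht0⟩ := (h0.and self_mem_nhdsWithin).exists
  refine ⟨_, interior_subset ht, ?_⟩
  rw [rdot_comm (μ + t • x), rdot_add, rdot_smul, rdot_comm x μ]
  have := mul_pos (show 0 < t from ht0) (rdot_self_pos hx)
  linarith

/-- If every vector making an obtuse angle with `η` has nonpositive inner product with `x`, then
`η` points in the direction of `x`. -/
lemma eq_enormR_mul_of_normal_cone {η x : Fin d → ℝ} (hη : η ≠ 0) (hx : x ≠ 0)
    (h : ∀ v, rdot η v < 0 → rdot x v ≤ 0) (j : Fin d) :
    η j = enormR η * (x j / enormR x) := by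
  have hη0 := enormR_pos hη
  have hx0 := enormR_pos hx
  have hge : enormR η * enormR x ≤ rdot η x := by
    by_contra! hlt
    have h1 := h (enormR η • x - enormR x • η) (by
      rw [rdot_sub, rdot_smul, rdot_smul, rdot_self]
      nlinarith)
    rw [rdot_sub, rdot_smul, rdot_smul, rdot_self, rdot_comm x η] at h1
    nlinarith
  have hzero : rdot (enormR x • η - enormR η • x) (enormR x • η - enormR η • x) ≤ 0 := by
    rw [rdot_sub, rdot_smul, rdot_smul, rdot_comm _ η, rdot_comm _ x, rdot_sub, rdot_sub,
      rdot_smul, rdot_smul, rdot_smul, rdot_smul, rdot_self, rdot_self, rdot_comm x η]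
    nlinarith [mul_pos hη0 hx0]
  have heq : enormR x • η - enormR η • x = 0 := by
    by_contra hne
    exact absurd hzero (not_le.mpr (rdot_self_pos hne))
  have hj := congrFun heq j
  simp only [Pi.sub_apply, Pi.smul_apply, smul_eq_mul, Pi.zero_apply] at hj
  field_simp
  linarith

variable {S J h : (Fin d → ℤ) → ℝ} {M K ζ : ℝ}

lemma AssumptionJweak.tiltControl (hJ : AssumptionJweak S J h M K ζ) {μ : Fin d → ℝ}
    (hμ : μ ∈ closure (Omega S)) : TiltControl J M K μ :=
  (hJ.memQ μ hμ).tiltControl hJ.M_pos.le hJ.zeta_pos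

lemma AssumptionOmega.convex_closure (hΩ : AssumptionOmega S) : Convex ℝ (closure (Omega S)) :=
  (convex_Omega hΩ.nonneg).closure

lemma AssumptionOmega.zero_mem_closure (hΩ : AssumptionOmega S) :
    (0 : Fin d → ℝ) ∈ closure (Omega S) :=
  subset_closure hΩ.zero_mem

lemma AssumptionOmega.smul_mem (hΩ : AssumptionOmega S) {μ : Fin d → ℝ}
    (hμ : μ ∈ closure (Omega S)) {t : ℝ} (h0 : 0 ≤ t) (h1 : t < 1) : t • μ ∈ Omega S := by
  have := (convex_Omega hΩ.nonneg).combo_interior_closure_mem_interior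
    (by rw [hΩ.open_Omega.interior_eq]; exact hΩ.zero_mem) hμ (sub_pos.mpr h1) h0 (by ring)
  rw [hΩ.open_Omega.interior_eq, smul_zero, zero_add] at this
  exact this

lemma AssumptionOmega.mem_frontier_iff (hΩ : AssumptionOmega S) {μ : Fin d → ℝ} :
    μ ∈ frontier (Omega S) ↔ μ ∈ closure (Omega S) ∧ μ ∉ Omega S := by
  rw [hΩ.open_Omega.frontier_eq, Set.mem_sdiff]

lemma AssumptionOmega.subset_interior_closure (hΩ : AssumptionOmega S) :
    Omega S ⊆ interior (closure (Omega S)) :=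
  hΩ.open_Omega.subset_interior_closure

/-- The Ornstein–Zernike equation summed over the lattice. -/
lemma susceptibility_mul_eq (hΩ : AssumptionOmega S) (hJ : AssumptionJweak S J h M K ζ)
    {μ : Fin d → ℝ} (hμ : μ ∈ Omega S) :
    (∑' x, S x * Real.exp (rdotZ μ x)) * (1 - tiltSum J μ) = tiltSum h μ := by
  have hS := (mem_Omega_iff hΩ.nonneg).mp hμ
  have hJs := (hJ.tiltControl (subset_closure hμ)).summable_zeroth
  have hhs : Summable (tilt h μ) :=
    (summable_of_lpNorm_one_le hJ.M_pos.le (hJ.memQ μ (subset_closure hμ)).g_l1).1.of_abs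
  have hOZ : ∀ x, conv (tilt J μ) (tilt S μ) x = S x * Real.exp (rdotZ μ x) - tilt h μ x :=
    fun x => by rw [conv_tilt, hJ.OZ_eq x, tilt]; ring
  have h1 := tsum_conv (f := tilt J μ) (g := tilt S μ) hJs hS
  rw [tsum_congr hOZ, hS.tsum_sub hhs] at h1
  change _ - tiltSum h μ = tiltSum J μ * ∑' x, S x * Real.exp (rdotZ μ x) at h1
  linarith

lemma tiltSum_h_le (hJ : AssumptionJweak S J h M K ζ) {μ : Fin d → ℝ}
    (hμ : μ ∈ closure (Omega S)) : tiltSum h μ ≤ M := by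
  obtain ⟨h1, h2⟩ := summable_of_lpNorm_one_le hJ.M_pos.le (hJ.memQ μ hμ).g_l1
  exact (h1.of_abs.tsum_le_tsum (fun y => le_abs_self _) h1).trans h2

lemma tiltSum_lt_one (hΩ : AssumptionOmega S) (hJ : AssumptionJweak S J h M K ζ)
    {μ : Fin d → ℝ} (hμ : μ ∈ Omega S) : tiltSum J μ < 1 := by
  have h1 := susceptibility_mul_eq hΩ hJ hμ
  have h2 := hJ.hhat_pos μ (subset_closure hμ)
  rw [← h1] at h2
  have h3 : 0 ≤ ∑' x, S x * Real.exp (rdotZ μ x) :=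
    tsum_nonneg fun x => mul_nonneg (hΩ.nonneg x) (Real.exp_pos _).le
  linarith [pos_of_mul_pos_right h2 h3]

lemma sum_mul_one_sub_tiltSum_le (hΩ : AssumptionOmega S) (hJ : AssumptionJweak S J h M K ζ)
    {μ : Fin d → ℝ} (hμ : μ ∈ Omega S) (s : Finset (Fin d → ℤ)) :
    (∑ x ∈ s, S x * Real.exp (rdotZ μ x)) * (1 - tiltSum J μ) ≤ M := by
  refine le_trans ?_ (tiltSum_h_le hJ (subset_closure hμ))
  rw [← susceptibility_mul_eq hΩ hJ hμ]
  refine mul_le_mul_of_nonneg_right ?_ (by linarith [tiltSum_lt_one hΩ hJ hμ])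
  exact ((mem_Omega_iff hΩ.nonneg).mp hμ).sum_le_tsum s
    fun x _ => mul_nonneg (hΩ.nonneg x) (Real.exp_pos _).le

lemma tendsto_tiltSum_smul (hJ : AssumptionJweak S J h M K ζ)
    {μ : Fin d → ℝ} (hμ : μ ∈ closure (Omega S)) :
    Tendsto (fun t : ℝ => tiltSum J (t • μ)) (𝓝[<] 1) (𝓝 (tiltSum J μ)) := by
  refine tendsto_tsum_of_dominated_convergence
    ((hJ.tiltControl hμ).summable_abs.add hJ.J_summable) (fun y => ?_) ?_
  · have hc : Continuous fun t : ℝ => J y * Real.exp (rdotZ (t • μ) y) := by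
      simp only [rdotZ_smul]; fun_prop
    simpa using (hc.tendsto 1).mono_left nhdsWithin_le_nhds
  · filter_upwards [Ioo_mem_nhdsLT (zero_lt_one' ℝ)] with t ht y
    rw [norm_mul, Real.norm_eq_abs, Real.norm_eq_abs, Real.abs_exp, rdotZ_smul]
    have := exp_mul_le_exp_add_one (rdotZ μ y) ht.1.le ht.2.le
    nlinarith [abs_nonneg (J y)]

lemma tiltSum_le_one (hΩ : AssumptionOmega S) (hJ : AssumptionJweak S J h M K ζ)
    {μ : Fin d → ℝ} (hμ : μ ∈ closure (Omega S)) : tiltSum J μ ≤ 1 := by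
  refine le_of_tendsto (tendsto_tiltSum_smul hJ hμ) ?_
  filter_upwards [Ioo_mem_nhdsLT (zero_lt_one' ℝ)] with t ht
  exact (tiltSum_lt_one hΩ hJ (hΩ.smul_mem hμ ht.1.le ht.2)).le

lemma mem_Omega_of_tiltSum_lt_one (hΩ : AssumptionOmega S) (hJ : AssumptionJweak S J h M K ζ)
    {μ : Fin d → ℝ} (hμ : μ ∈ closure (Omega S)) (hlt : tiltSum J μ < 1) : μ ∈ Omega S := by
  rw [mem_Omega_iff hΩ.nonneg]
  refine summable_of_sum_le (c := M / (1 - tiltSum J μ))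
    (fun x => mul_nonneg (hΩ.nonneg x) (Real.exp_pos _).le) fun s => ?_
  rw [le_div_iff₀ (sub_pos.mpr hlt)]
  have hc : Continuous fun t : ℝ => ∑ x ∈ s, S x * Real.exp (rdotZ (t • μ) x) := by
    simp only [rdotZ_smul]; fun_prop
  have hc1 := (hc.tendsto 1).mono_left (nhdsWithin_le_nhds (s := Set.Iio 1))
  simp only [one_smul] at hc1
  refine le_of_tendsto (hc1.mul ((tendsto_tiltSum_smul hJ hμ).const_sub 1)) ?_
  filter_upwards [Ioo_mem_nhdsLT (zero_lt_one' ℝ)] with t ht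
  exact sum_mul_one_sub_tiltSum_le hΩ hJ (hΩ.smul_mem hμ ht.1.le ht.2) s

lemma tiltSum_eq_one_iff (hΩ : AssumptionOmega S) (hJ : AssumptionJweak S J h M K ζ)
    {μ : Fin d → ℝ} (hμ : μ ∈ closure (Omega S)) :
    tiltSum J μ = 1 ↔ μ ∈ frontier (Omega S) := by
  rw [hΩ.mem_frontier_iff]
  refine ⟨fun heq => ⟨hμ, fun hmem => (tiltSum_lt_one hΩ hJ hmem).ne heq⟩, fun hmem => ?_⟩
  by_contra hne
  exact hmem.2 (mem_Omega_of_tiltSum_lt_one hΩ hJ hμ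
    (lt_of_le_of_ne (tiltSum_le_one hΩ hJ hμ) hne))

lemma tiltSum_lower_bound (hΩ : AssumptionOmega S) (hJ : AssumptionJweak S J h M K ζ)
    {μ ν : Fin d → ℝ} (hμ : μ ∈ closure (Omega S)) (hν : ν ∈ closure (Omega S)) :
    tiltSum J μ + rdot (etaOf J μ) (ν - μ) + K * enormR (ν - μ) ^ 2 ≤ tiltSum J ν :=
  (hJ.tiltControl hμ).tiltSum_ge (hJ.tiltControl hν) fun _ h0 h1 =>
    hJ.tiltControl (hΩ.convex_closure.add_smul_sub_mem hμ hν ⟨h0, h1⟩)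

lemma tiltSum_upper_bound (hJ : AssumptionJweak S J h M K ζ)
    {μ ν : Fin d → ℝ} (hμ : μ ∈ closure (Omega S)) (hν : ν ∈ closure (Omega S)) :
    tiltSum J ν ≤ tiltSum J μ + rdot (etaOf J μ) (ν - μ) + 2 * M * enormR (ν - μ) ^ 2 := by
  linarith [(abs_le.mp ((hJ.tiltControl hμ).tiltSum_le (hJ.tiltControl hν))).2]

lemma midpoint_mem_Omega (hΩ : AssumptionOmega S) (hJ : AssumptionJweak S J h M K ζ)
    {μ ν : Fin d → ℝ} (hμ : μ ∈ closure (Omega S)) (hν : ν ∈ closure (Omega S)) (hne : μ ≠ ν) :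
    (1 / 2 : ℝ) • (μ + ν) ∈ Omega S := by
  have hm : (1 / 2 : ℝ) • (μ + ν) ∈ closure (Omega S) := by
    rw [smul_add]
    exact hΩ.convex_closure hμ hν (by norm_num) (by norm_num) (by norm_num)
  refine mem_Omega_of_tiltSum_lt_one hΩ hJ hm ?_
  have h1 := tiltSum_lower_bound hΩ hJ hm hμ
  have h2 := tiltSum_lower_bound hΩ hJ hm hν
  have h3 : ν - (1 / 2 : ℝ) • (μ + ν) = -(μ - (1 / 2 : ℝ) • (μ + ν)) := by module
  have h4 : μ - (1 / 2 : ℝ) • (μ + ν) ≠ 0 := by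
    have : μ - (1 / 2 : ℝ) • (μ + ν) = (1 / 2 : ℝ) • (μ - ν) := by module
    rw [this]
    exact smul_ne_zero (by norm_num) (sub_ne_zero.mpr hne)
  rw [h3, rdot_neg] at h2
  have h5 := mul_pos hJ.K_pos (pow_pos (enormR_pos h4) 2)
  have h6 := mul_nonneg hJ.K_pos.le (sq_nonneg (enormR (-(μ - (1 / 2 : ℝ) • (μ + ν)))))
  linarith [tiltSum_le_one hΩ hJ hμ, tiltSum_le_one hΩ hJ hν]

lemma enormR_sq_le_div (hΩ : AssumptionOmega S) (hJ : AssumptionJweak S J h M K ζ)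
    {μ : Fin d → ℝ} (hμ : μ ∈ closure (Omega S)) : enormR μ ^ 2 ≤ M / K := by
  have hneg := neg_mem_closure_Omega hΩ.nonneg hΩ.symm hμ
  have h0 := hΩ.zero_mem_closure
  have h1 := tiltSum_lower_bound hΩ hJ h0 hμ
  have h2 := tiltSum_lower_bound hΩ hJ h0 hneg
  rw [sub_zero] at h1 h2
  rw [rdot_neg, tiltSum_neg hJ.J_symm] at h2
  have h3 : enormR (-μ) = enormR μ := by simp [enormR]
  rw [h3] at h2
  have hs := (hJ.tiltControl hμ).summable_zeroth
  have hsn := (hJ.tiltControl hneg).summable_zeroth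
  have hs0 := (hJ.tiltControl h0).summable_zeroth
  have ha := (hJ.tiltControl hμ).summable_abs
  have han := (hJ.tiltControl hneg).summable_abs
  have hle : ∀ y, J y * Real.exp (rdotZ μ y) + J y * Real.exp (rdotZ (-μ) y)
      - 2 * (J y * Real.exp (rdotZ 0 y)) ≤
      |J y| * Real.exp (rdotZ μ y) + |J y| * Real.exp (rdotZ (-μ) y) := fun y => by
    rw [rdotZ_neg, rdotZ_zero, Real.exp_zero]
    have h4 := Real.add_one_le_exp (rdotZ μ y)
    have h5 := Real.add_one_le_exp (-rdotZ μ y)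
    nlinarith [le_abs_self (J y), neg_abs_le (J y)]
  have h6 := ((hs.add hsn).sub (hs0.mul_left 2)).tsum_le_tsum hle (ha.add han)
  rw [(hs.add hsn).tsum_sub (hs0.mul_left 2), hs.tsum_add hsn, ha.tsum_add han,
    tsum_mul_left] at h6
  change tiltSum J μ + tiltSum J (-μ) - 2 * tiltSum J 0 ≤ _ at h6
  rw [tiltSum_neg hJ.J_symm] at h6
  rw [le_div_iff₀ hJ.K_pos]
  linarith [(hJ.tiltControl hμ).tsum_abs_le, (hJ.tiltControl hneg).tsum_abs_le]

lemma isCompact_closure_Omega (hΩ : AssumptionOmega S) (hJ : AssumptionJweak S J h M K ζ) :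
    IsCompact (closure (Omega S)) := by
  refine Metric.isCompact_of_isClosed_isBounded isClosed_closure
    ((Metric.isBounded_closedBall (x := 0) (r := Real.sqrt (M / K))).subset fun μ hμ => ?_)
  rw [mem_closedBall_zero_iff, pi_norm_le_iff_of_nonneg (Real.sqrt_nonneg _)]
  exact fun i => (abs_coord_le_enormR μ i).trans
    (Real.le_sqrt_of_sq_le (enormR_sq_le_div hΩ hJ hμ))

lemma existsUnique_isOptTilt (hΩ : AssumptionOmega S) (hJ : AssumptionJweak S J h M K ζ)
    {x : Fin d → ℝ} (hx : x ≠ 0) : ∃! μ, IsOptTilt S x μ := by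
  obtain ⟨μ, hμ, hmax⟩ := (isCompact_closure_Omega hΩ hJ).exists_isMaxOn
    ⟨0, hΩ.zero_mem_closure⟩ (continuous_rdot x).continuousOn
  refine ⟨μ, ⟨hΩ.mem_frontier_iff.mpr ⟨hμ, fun hmem => ?_⟩, fun ν hν => hmax hν⟩, ?_⟩
  · obtain ⟨ν, hν, hlt⟩ :=
      exists_rdot_lt_of_mem_interior (hΩ.subset_interior_closure hmem) hx
    exact absurd (hmax hν) (not_le.mpr hlt)
  · rintro ν ⟨hνf, hνmax⟩
    by_contra hne
    have hν := frontier_subset_closure hνf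
    obtain ⟨p, hp, hlt⟩ := exists_rdot_lt_of_mem_interior
      (hΩ.subset_interior_closure (midpoint_mem_Omega hΩ hJ hν hμ hne)) hx
    rw [rdot_comm _ x, rdot_smul, rdot_add, rdot_comm x, rdot_comm x] at hlt
    have h1 := hνmax p hp
    have h2 : rdot p x ≤ rdot μ x := hmax hp
    linarith

lemma isOptTilt_smul {t : ℝ} (ht : 0 < t) {x μ : Fin d → ℝ} (h : IsOptTilt S x μ) :
    IsOptTilt S (t • x) μ := by
  refine ⟨h.1, fun ν hν => ?_⟩
  rw [rdot_smul, rdot_smul]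
  exact mul_le_mul_of_nonneg_left (h.2 ν hν) ht.le

lemma rdot_etaOf_self_gt (hΩ : AssumptionOmega S) (hJ : AssumptionJweak S J h M K ζ)
    {μ : Fin d → ℝ} (hμ : μ ∈ frontier (Omega S)) :
    K * enormR μ ^ 2 < rdot (etaOf J μ) μ := by
  have hc := frontier_subset_closure hμ
  have h1 := tiltSum_lower_bound hΩ hJ hc hΩ.zero_mem_closure
  rw [(tiltSum_eq_one_iff hΩ hJ hc).mpr hμ, zero_sub, rdot_neg] at h1
  have h3 : enormR (-μ) = enormR μ := by simp [enormR]
  rw [h3] at h1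
  linarith [tiltSum_lt_one hΩ hJ hΩ.zero_mem]

lemma mul_enormR_le_enormR_etaOf (hΩ : AssumptionOmega S) (hJ : AssumptionJweak S J h M K ζ)
    {μ : Fin d → ℝ} (hμ : μ ∈ frontier (Omega S)) :
    K * enormR μ ≤ enormR (etaOf J μ) := by
  have h1 := rdot_etaOf_self_gt hΩ hJ hμ
  have h2 := (le_abs_self _).trans (abs_rdot_le (etaOf J μ) μ)
  rcases (enormR_nonneg μ).eq_or_lt with h0 | h0
  · rw [← h0, mul_zero]
    exact enormR_nonneg _
  · refine le_of_mul_le_mul_right ?_ h0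
    linarith

/-- At a boundary point, the tangent cone of `Ω̄` contains the open half-space on which the
gradient of the tilted sum is negative. -/
lemma exists_add_smul_mem_closure_Omega (hΩ : AssumptionOmega S)
    (hJ : AssumptionJweak S J h M K ζ) {μ v : Fin d → ℝ} (hμ : μ ∈ frontier (Omega S))
    (hv : rdot (etaOf J μ) v < 0) : ∃ t : ℝ, 0 < t ∧ μ + t • v ∈ closure (Omega S) := by
  set η := etaOf J μ with hη
  have hc := frontier_subset_closure hμ
  have hημ : 0 < rdot η μ :=
    (mul_nonneg hJ.K_pos.le (sq_nonneg _)).trans_lt (rdot_etaOf_self_gt hΩ hJ hμ)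
  obtain ⟨ε, hε, hε1, hε2⟩ : ∃ ε : ℝ, 0 < ε ∧ ε ≤ -rdot η v ∧ ε ≤ rdot η μ :=
    ⟨min (-rdot η v) (rdot η μ), lt_min (by linarith) hημ, min_le_left _ _, min_le_right _ _⟩
  set B := ∑ i, (|v i| + |μ i|) with hB
  have hB0 : 0 ≤ B := Finset.sum_nonneg fun i _ => by positivity
  have hMpos := hJ.M_pos
  obtain ⟨t, ht0, ht1, ht2⟩ : ∃ t : ℝ, 0 < t ∧ t < 1 ∧ t * (2 * M * B ^ 2 + 1) ≤ ε / 2 := by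
    have hD : 0 < 2 * M * B ^ 2 + 1 := by positivity
    refine ⟨min (1 / 2) (ε / 2 / (2 * M * B ^ 2 + 1)), by positivity,
      (min_le_left _ _).trans_lt (by norm_num), ?_⟩
    rw [← le_div_iff₀ hD]
    exact min_le_right _ _
  refine ⟨t, ht0, ?_⟩
  by_contra hout
  have hin : (1 - t) • μ ∈ Omega S := hΩ.smul_mem hc (by linarith) (by linarith)
  obtain ⟨p, hpseg, hp⟩ : ∃ p ∈ segment ℝ ((1 - t) • μ) (μ + t • v), p ∈ frontier (Omega S) := by
    by_contra! hno
    obtain ⟨q, -, hq1, hq2⟩ := (convex_segment (𝕜 := ℝ) ((1 - t) • μ) (μ + t • v)).isPreconnected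
      (Omega S) (closure (Omega S))ᶜ hΩ.open_Omega isClosed_closure.isOpen_compl
      (fun q hq => by
        by_contra hq'
        simp only [Set.mem_union, Set.mem_compl_iff, not_or, not_not] at hq'
        exact hno q hq (hΩ.mem_frontier_iff.mpr hq'.symm))
      ⟨_, left_mem_segment ℝ _ _, hin⟩ ⟨_, right_mem_segment ℝ _ _, hout⟩
    exact hq2 (subset_closure hq1)
  obtain ⟨a, θ, ha, hθ, hab, rfl⟩ := hpseg
  have hpc := frontier_subset_closure hp
  have h1 := tiltSum_upper_bound hJ hc hpc
  rw [(tiltSum_eq_one_iff hΩ hJ hc).mpr hμ, (tiltSum_eq_one_iff hΩ hJ hpc).mpr hp] at h1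
  have hdiff : a • (1 - t) • μ + θ • (μ + t • v) - μ = t • (θ • v - a • μ) := by
    rw [show a = 1 - θ by linarith]; module
  rw [hdiff, rdot_smul, rdot_sub, rdot_smul, rdot_smul, enormR_smul] at h1
  have h2 : θ * rdot η v - a * rdot η μ ≤ -ε := by
    have : ε = θ * ε + a * ε := by rw [← add_mul, add_comm θ, hab, one_mul]
    nlinarith
  have h3 : enormR (θ • v - a • μ) ≤ B := by
    refine (enormR_le_sum_abs _).trans (Finset.sum_le_sum fun i _ => ?_)
    refine (abs_sub _ _).trans ?_
    simp only [Pi.smul_apply, smul_eq_mul, abs_mul, abs_of_nonneg ha, abs_of_nonneg hθ]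
    nlinarith [abs_nonneg (v i), abs_nonneg (μ i)]
  have h4 : enormR (θ • v - a • μ) ^ 2 ≤ B ^ 2 := pow_le_pow_left₀ (enormR_nonneg _) h3 2
  have h5 : 0 ≤ t * (-ε + 2 * M * t * B ^ 2) := by
    have h6 := mul_le_mul_of_nonneg_left h2 ht0.le
    have h7 := mul_le_mul_of_nonneg_left h4 (show 0 ≤ 2 * M * t ^ 2 by positivity)
    linarith
  have h8 := nonneg_of_mul_nonneg_right h5 ht0
  linarith

lemma etaOf_direction (hΩ : AssumptionOmega S) (hJ : AssumptionJweak S J h M K ζ)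
    {x μ : Fin d → ℝ} (hx : x ≠ 0) (hμ : IsOptTilt S x μ) (j : Fin d) :
    etaOf J μ j = enormR (etaOf J μ) * (x j / enormR x) := by
  refine eq_enormR_mul_of_normal_cone ?_ hx (fun v hv => ?_) j
  · intro h0
    have h1 := rdot_etaOf_self_gt hΩ hJ hμ.1
    have h2 : rdot (0 : Fin d → ℝ) μ = 0 := by simp [rdot]
    rw [h0, h2] at h1
    exact absurd h1 (not_lt.mpr (mul_nonneg hJ.K_pos.le (sq_nonneg _)))
  · obtain ⟨t, ht, hmem⟩ := exists_add_smul_mem_closure_Omega hΩ hJ hμ.1 hv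
    have h1 := hμ.2 _ hmem
    rw [rdot_comm _ x, rdot_add, rdot_smul, rdot_comm x μ] at h1
    by_contra! hlt
    linarith [mul_pos ht hlt]

lemma e1R_eq_single (hd : 1 ≤ d) (t : ℝ) : e1R d t = Pi.single (⟨0, hd⟩ : Fin d) t := by
  funext i
  by_cases hi : i = ⟨0, hd⟩
  · subst hi; simp [e1R]
  · have : (i : ℕ) ≠ 0 := fun h0 => hi (Fin.ext h0)
    simp [e1R, hi, this]

lemma single_comp_swap (i j : Fin d) (t : ℝ) :
    (fun l => (Pi.single i t : Fin d → ℝ) (Equiv.swap i j l)) = Pi.single j t := by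
  funext l
  simp only [Pi.single_apply, Equiv.swap_apply_eq_iff, Equiv.swap_apply_left]

lemma bddAbove_mass_set (hd : 1 ≤ d) (hΩ : AssumptionOmega S)
    (hJ : AssumptionJweak S J h M K ζ) :
    BddAbove {t : ℝ | 0 ≤ t ∧ chi S (e1R d t) < ⊤} := by
  refine ⟨Real.sqrt (M / K), fun t ht => Real.le_sqrt_of_sq_le ?_⟩
  refine le_trans ?_ (enormR_sq_le_div hΩ hJ (subset_closure (show e1R d t ∈ Omega S from ht.2)))
  refine pow_le_pow_left₀ ht.1 ((le_abs_self t).trans ?_) 2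
  simpa [e1R] using abs_coord_le_enormR (e1R d t) ⟨0, hd⟩

lemma mass_nonneg (S : (Fin d → ℤ) → ℝ) : 0 ≤ mass S :=
  Real.sSup_nonneg fun _ ht => ht.1

lemma abs_coord_le_mass (hd : 1 ≤ d) (hΩ : AssumptionOmega S)
    (hJ : AssumptionJweak S J h M K ζ) {ν : Fin d → ℝ} (hν : ν ∈ closure (Omega S))
    (i : Fin d) : |ν i| ≤ mass S := by
  have hsingle : (Pi.single i (ν i) : Fin d → ℝ) ∈ closure (Omega S) := by
    have hflip := flip_mem_closure_Omega hΩ.nonneg hΩ.symm (fun j => decide (j ≠ i)) hν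
    have hmid := hΩ.convex_closure hν hflip (show (0 : ℝ) ≤ 1 / 2 by norm_num)
      (show (0 : ℝ) ≤ 1 / 2 by norm_num) (by norm_num)
    convert hmid using 1
    funext j
    by_cases hj : j = i
    · subst hj; simp; ring
    · simp [hj]
  have hpos : (Pi.single i |ν i| : Fin d → ℝ) ∈ closure (Omega S) := by
    rcases abs_choice (ν i) with habs | habs <;> rw [habs]
    · exact hsingle
    · rw [Pi.single_neg]
      exact neg_mem_closure_Omega hΩ.nonneg hΩ.symm hsingle
  have hfirst := perm_mem_closure_Omega hΩ.nonneg hΩ.symm (Equiv.swap i ⟨0, hd⟩) hpos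
  rw [single_comp_swap, ← e1R_eq_single] at hfirst
  have hlim : Tendsto (fun s : ℝ => s * |ν i|) (𝓝[<] 1) (𝓝 |ν i|) := by
    have hc : Continuous fun s : ℝ => s * |ν i| := by fun_prop
    simpa using (hc.tendsto 1).mono_left nhdsWithin_le_nhds
  refine le_of_tendsto hlim ?_
  filter_upwards [Ioo_mem_nhdsLT (zero_lt_one' ℝ)] with s hs
  refine le_csSup (bddAbove_mass_set hd hΩ hJ) ⟨mul_nonneg hs.1.le (abs_nonneg _), ?_⟩
  have hmem := hΩ.smul_mem hfirst hs.1.le hs.2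
  rw [e1R_eq_single hd, ← Pi.single_smul, smul_eq_mul, ← e1R_eq_single hd] at hmem
  exact hmem

lemma mass_mul_abs_coord_le (hd : 1 ≤ d) (hΩ : AssumptionOmega S) {x μ : Fin d → ℝ}
    (hμ : ∀ ν ∈ closure (Omega S), rdot ν x ≤ rdot μ x) (i : Fin d) :
    mass S * |x i| ≤ rdot μ x := by
  have hmem : ∀ t ∈ {t : ℝ | 0 ≤ t ∧ chi S (e1R d t) < ⊤}, t * |x i| ≤ rdot μ x := by
    rintro t ⟨-, ht⟩
    have h1 : e1R d t ∈ closure (Omega S) := subset_closure ht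
    have h2 := perm_mem_closure_Omega hΩ.nonneg hΩ.symm (Equiv.swap ⟨0, hd⟩ i) h1
    rw [e1R_eq_single hd, single_comp_swap] at h2
    have hval : rdot (Pi.single i t) x = t * x i := by simp [rdot, Pi.single_apply]
    have h3 := hμ _ h2
    have h4 := hμ _ (neg_mem_closure_Omega hΩ.nonneg hΩ.symm h2)
    rw [rdot_comm _ x, rdot_neg, rdot_comm x] at h4
    rw [hval] at h3 h4
    rcases abs_choice (x i) with habs | habs <;> rw [habs] <;> linarith
  rcases (abs_nonneg (x i)).eq_or_lt with h0 | h0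
  · have := hμ 0 hΩ.zero_mem_closure
    rw [← h0, mul_zero]
    simpa [rdot] using this
  · rw [← le_div_iff₀ h0]
    refine csSup_le ⟨0, le_rfl, ?_⟩ fun t ht => (le_div_iff₀ h0).mpr (hmem t ht)
    have : e1R d 0 = 0 := by funext i; simp [e1R]
    rw [this]
    exact hΩ.zero_mem

lemma mass_mul_enormR_le (hd : 1 ≤ d) (hΩ : AssumptionOmega S) {x μ : Fin d → ℝ}
    (hμ : ∀ ν ∈ closure (Omega S), rdot ν x ≤ rdot μ x) :
    1 / d * (mass S * enormR x) ≤ rdot μ x := by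
  have hd0 : (0 : ℝ) < d := by exact_mod_cast hd
  have h1 : mass S * enormR x ≤ ∑ i, mass S * |x i| := by
    rw [← Finset.mul_sum]
    exact mul_le_mul_of_nonneg_left (enormR_le_sum_abs x) (mass_nonneg S)
  have h2 := Finset.sum_le_card_nsmul Finset.univ (fun i => mass S * |x i|) (rdot μ x)
    fun i _ => mass_mul_abs_coord_le hd hΩ hμ i
  rw [Finset.card_univ, Fintype.card_fin, nsmul_eq_mul] at h2
  rw [one_div, inv_mul_le_iff₀ hd0]
  exact h1.trans h2

lemma enormR_le_mass (hd : 1 ≤ d) (hΩ : AssumptionOmega S)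
    (hJ : AssumptionJweak S J h M K ζ) {μ : Fin d → ℝ} (hμ : μ ∈ closure (Omega S)) :
    enormR μ ≤ d * mass S := by
  refine (enormR_le_sum_abs μ).trans ?_
  have := Finset.sum_le_card_nsmul Finset.univ (fun i => |μ i|) (mass S)
    fun i _ => abs_coord_le_mass hd hΩ hJ hμ i
  simpa using this

theorem statement2 (d : ℕ) (hd : 1 ≤ d) (M K : ℝ) (hM : 0 < M) (hK : 0 < K) :
    ∃ c C : ℝ, 0 < c ∧ c ≤ C ∧
      ∀ (ζ : ℝ) (S J h : (Fin d → ℤ) → ℝ),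
        AssumptionOmega S → AssumptionJweak S J h M K ζ →
        ((∀ μ ∈ closure (Omega S), ∀ ν ∈ closure (Omega S), μ ≠ ν →
            (1 / 2 : ℝ) • (μ + ν) ∈ interior (closure (Omega S))) ∧
         (∀ μ ∈ closure (Omega S), enormR μ ^ 2 ≤ M / K) ∧
         (∀ μ ∈ closure (Omega S),
            tiltSum J μ ≤ 1 ∧ (tiltSum J μ = 1 ↔ μ ∈ frontier (Omega S))) ∧
         (∀ x : Fin d → ℝ, x ≠ 0 →
            (∃! μ : Fin d → ℝ, IsOptTilt S x μ) ∧
            (∀ t : ℝ, 0 < t → ∀ μ : Fin d → ℝ, IsOptTilt S x μ → IsOptTilt S (t • x) μ) ∧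
            (∀ μ : Fin d → ℝ, IsOptTilt S x μ →
              (∀ j, etaOf J μ j = enormR (etaOf J μ) * (x j / enormR x)) ∧
              (c * (mass S * enormR x) ≤ rdot μ x ∧ rdot μ x ≤ C * (mass S * enormR x)) ∧
              (c * mass S ≤ enormR (etaOf J μ) ∧ enormR (etaOf J μ) ≤ C * mass S) ∧
              (∀ k : Fin d → ℝ, c * enormR k ^ 2 ≤ rdot k (LambdaOf J μ *ᵥ k) ∧
                rdot k (LambdaOf J μ *ᵥ k) ≤ C * enormR k ^ 2)))) := by
  have hd0 : (0 : ℝ) < d := by exact_mod_cast hd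
  set c : ℝ := min (1 / d) (min (K / d) (2 * K)) with hc
  have hc0 : 0 < c := by positivity
  have hc1 : c ≤ 1 / d := min_le_left _ _
  have hc2 : c ≤ K / d := (min_le_right _ _).trans (min_le_left _ _)
  have hc3 : c ≤ 2 * K := (min_le_right _ _).trans (min_le_right _ _)
  have hMd : 0 < 2 * M * d := by positivity
  refine ⟨c, c + d + 2 * M * d + M, hc0, by linarith, ?_⟩
  intro ζ S J h hΩ hJ
  have hm := mass_nonneg S
  refine ⟨fun μ hμ ν hν hne => hΩ.subset_interior_closure (midpoint_mem_Omega hΩ hJ hμ hν hne),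
    fun μ hμ => enormR_sq_le_div hΩ hJ hμ,
    fun μ hμ => ⟨tiltSum_le_one hΩ hJ hμ, tiltSum_eq_one_iff hΩ hJ hμ⟩,
    fun x hx => ⟨existsUnique_isOptTilt hΩ hJ hx, fun t ht μ hμ => isOptTilt_smul ht hμ,
      fun μ hμ => ⟨etaOf_direction hΩ hJ hx hμ, ?_, ?_, ?_⟩⟩⟩
  all_goals have hμc := frontier_subset_closure hμ.1
  all_goals have hlow := mass_mul_enormR_le hd hΩ hμ.2
  all_goals have hup := enormR_le_mass hd hΩ hJ hμc
  all_goals have hcs := (le_abs_self _).trans (abs_rdot_le μ x)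
  all_goals have hx0 := enormR_pos hx
  · have hmx : 0 ≤ mass S * enormR x := mul_nonneg hm hx0.le
    refine ⟨(mul_le_mul_of_nonneg_right hc1 hmx).trans hlow, ?_⟩
    calc rdot μ x ≤ d * mass S * enormR x :=
          hcs.trans (mul_le_mul_of_nonneg_right hup hx0.le)
      _ = d * (mass S * enormR x) := by ring
      _ ≤ _ := mul_le_mul_of_nonneg_right (by linarith) hmx
  · constructor
    · have h1 : 1 / d * mass S ≤ enormR μ := by
        refine le_of_mul_le_mul_right ?_ hx0
        linarith
      calc c * mass S ≤ K / d * mass S := mul_le_mul_of_nonneg_right hc2 hm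
        _ = K * (1 / d * mass S) := by ring
        _ ≤ K * enormR μ := mul_le_mul_of_nonneg_left h1 hK.le
        _ ≤ _ := mul_enormR_le_enormR_etaOf hΩ hJ hμ.1
    · calc enormR (etaOf J μ) ≤ 2 * M * enormR μ :=
            (hJ.tiltControl hμc).enormR_etaOf_le hJ.J_symm
              (hJ.tiltControl (neg_mem_closure_Omega hΩ.nonneg hΩ.symm hμc))
        _ ≤ 2 * M * (d * mass S) := mul_le_mul_of_nonneg_left hup (by positivity)
        _ = 2 * M * d * mass S := by ring
        _ ≤ _ := mul_le_mul_of_nonneg_right (by linarith) hm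
  · intro k
    have hctl := hJ.tiltControl hμc
    rw [hctl.rdot_LambdaOf]
    have hk := sq_nonneg (enormR k)
    exact ⟨(mul_le_mul_of_nonneg_right hc3 hk).trans (hctl.covariance_lower k),
      (hctl.covariance_upper k).trans (mul_le_mul_of_nonneg_right (by linarith) hk)⟩

end OZpaper
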